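/- In the Example-1 economy: (i) the matching m_{a2} that matches a1–b1 in period 1 and a2–b2, a3–b3, a4–b4 in period 2 is a rational expectations solution of E^2_{\a2} (the economy with a2's arrival delayed to period 2); and (ii) the matching m_{b1} that matches a3–b2 in period 1 and a1–b1, a2–b4, a4–b3 in period 2 is a rational expectations solution of E^2_{\b1} (the economy with b1's arrival delayed to period 2). -/

import Mathlib

/-!
A framework for two-sided, one-to-one, irreversible dynamic matching markets
with conjectures, following Doval's "A framework for (dynamic) stability".

Periods are indexed `0, …, T-1` (the paper's periods `1, …, T`).
-/

namespace DynMatch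

open Classical

noncomputable section

/-- A length-`T` two-sided dynamic economy: the arrivals on each side in each period. -/
structure Economy (A B : Type) where
  T : ℕ
  arrA : ℕ → Finset A
  arrB : ℕ → Finset B

/-- Validity of an economy: positive length, pairwise disjoint arrivals, and
no arrivals outside the horizon. -/
def Economy.Valid {A B : Type} (E : Economy A B) : Prop :=
  0 < E.T ∧
  (∀ s t, s ≠ t → Disjoint (E.arrA s) (E.arrA t)) ∧
  (∀ s t, s ≠ t → Disjoint (E.arrB s) (E.arrB t)) ∧
  (∀ s, E.T ≤ s → E.arrA s = ∅) ∧ (∀ s, E.T ≤ s → E.arrB s = ∅)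

/-- A raw dynamic matching: in every period, a partial pairing between the two sides
(`none` means unmatched, i.e. matched to oneself). -/
structure PreMatching (A B : Type) where
  mA : ℕ → A → Option B
  mB : ℕ → B → Option A

variable {A B : Type} [DecidableEq A] [DecidableEq B]

/-- Side-`A` agents having arrived up to (and including) period `t`. -/
def arrAUpTo (E : Economy A B) (t : ℕ) : Finset A := (Finset.range (t+1)).biUnion E.arrA

/-- Side-`B` agents having arrived up to (and including) period `t`. -/
def arrBUpTo (E : Economy A B) (t : ℕ) : Finset B := (Finset.range (t+1)).biUnion E.arrB

/-- `m` is an irreversible dynamic matching for the economy `E`: in every period it is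
an involutive pairing between arrived agents of the two sides, and once matched a
pair stays matched. -/
def IsMatching (E : Economy A B) (m : PreMatching A B) : Prop :=
  (∀ t a b, t < E.T → (m.mA t a = some b ↔ m.mB t b = some a)) ∧
  (∀ t a, t < E.T → m.mA t a ≠ none → a ∈ arrAUpTo E t) ∧
  (∀ t a b, t < E.T → m.mA t a = some b → b ∈ arrBUpTo E t) ∧
  (∀ t s a, t ≤ s → s < E.T → m.mA t a ≠ none → m.mA s a = m.mA t a) ∧
  (∀ t s b, t ≤ s → s < E.T → m.mB t b ≠ none → m.mB s b = m.mB t b)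

/-- The everywhere-unmatched prematching. -/
def emptyM : PreMatching A B := ⟨fun _ _ => none, fun _ _ => none⟩

/-- An agent of the economy: a side-`A` or a side-`B` agent. -/
abbrev Agent (A B : Type) := A ⊕ B

/-- `𝒜_t(m^{t-1})`: side-`A` agents available to match in period `t` given history `m`. -/
def availA (E : Economy A B) (m : PreMatching A B) (t : ℕ) : Finset A :=
  (arrAUpTo E t).filter fun a => ∀ s, s < t → m.mA s a = none

/-- `ℬ_t(m^{t-1})`: side-`B` agents available to match in period `t` given history `m`. -/
def availB (E : Economy A B) (m : PreMatching A B) (t : ℕ) : Finset B :=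
  (arrBUpTo E t).filter fun b => ∀ s, s < t → m.mB s b = none

/-- `k ∈ 𝒜_t(m^{t-1}) ∪ ℬ_t(m^{t-1})`. -/
def isAvail (E : Economy A B) (m : PreMatching A B) (t : ℕ) : Agent A B → Prop
  | Sum.inl a => a ∈ availA E m t
  | Sum.inr b => b ∈ availB E m t

/-- `k ∈ A_1 ∪ B_1`: `k` is a first-period arrival. -/
def inPeriodOne (E : Economy A B) : Agent A B → Prop
  | Sum.inl a => a ∈ E.arrA 0
  | Sum.inr b => b ∈ E.arrB 0

/-- `m_t(k) = k`: agent `k` is unmatched in period `t` under `m`. -/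
def unmatchedAt (m : PreMatching A B) (t : ℕ) : Agent A B → Prop
  | Sum.inl a => m.mA t a = none
  | Sum.inr b => m.mB t b = none

/-- `m` and `m'` agree in all periods `s < t` (i.e. they share the history `m^{t-1}`). -/
def agreeUpTo (m m' : PreMatching A B) (t : ℕ) : Prop :=
  ∀ s, s < t → (∀ a, m.mA s a = m'.mA s a) ∧ (∀ b, m.mB s b = m'.mB s b)

/-- Agent `k` is unmatched through period `t` (all periods `s ≤ t`) under `m`. -/
def unmatchedThrough (m : PreMatching A B) (t : ℕ) : Agent A B → Prop
  | Sum.inl a => ∀ s, s ≤ t → m.mA s a = none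
  | Sum.inr b => ∀ s, s ≤ t → m.mB s b = none

/-- `M_T(m^{t-1})`: matchings of `E` agreeing with `m` through period `t-1`. -/
def MSetH (E : Economy A B) (m : PreMatching A B) (t : ℕ) : Set (PreMatching A B) :=
  {m' | IsMatching E m' ∧ agreeUpTo m m' t}

/-- `M_T(m^{t-1}, k)`: matchings of `E` agreeing with `m` through period `t-1` and
leaving `k` unmatched through period `t`. -/
def MSet (E : Economy A B) (m : PreMatching A B) (t : ℕ) (k : Agent A B) :
    Set (PreMatching A B) :=
  {m' | IsMatching E m' ∧ agreeUpTo m m' t ∧ unmatchedThrough m' t k}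

/-- Preferences: Bernoulli utilities on both sides and discount factors.
(The payoff of remaining single is normalized to `0`.) -/
structure Pref (A B : Type) where
  u : A → B → ℝ
  v : A → B → ℝ
  dA : A → ℝ
  dB : B → ℝ

/-- Discount factors lie in `[0,1]`. -/
def Pref.Valid (P : Pref A B) : Prop :=
  (∀ a, 0 ≤ P.dA a ∧ P.dA a ≤ 1) ∧ (∀ b, 0 ≤ P.dB b ∧ P.dB b ≤ 1)

/-- `t_m(a)`: the first period `s ≥ t` at which `a` is matched under `m` (`T` if never). -/
def matchTimeA (E : Economy A B) (m : PreMatching A B) (t : ℕ) (a : A) : ℕ :=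
  min (sInf {s | t ≤ s ∧ m.mA s a ≠ none}) E.T

/-- `t_m(b)`: the first period `s ≥ t` at which `b` is matched under `m` (`T` if never). -/
def matchTimeB (E : Economy A B) (m : PreMatching A B) (t : ℕ) (b : B) : ℕ :=
  min (sInf {s | t ≤ s ∧ m.mB s b ≠ none}) E.T

/-- `U_t(a,m) = δ_a^{t_m(a)-t}·u(a, m_T(a))` (and `0` if `a` ends up unmatched). -/
def Upay (P : Pref A B) (E : Economy A B) (m : PreMatching A B) (t : ℕ) (a : A) : ℝ :=
  match m.mA (E.T - 1) a with
  | none => 0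
  | some b => P.dA a ^ (matchTimeA E m t a - t) * P.u a b

/-- `V_t(b,m) = δ_b^{t_m(b)-t}·v(m_T(b), b)` (and `0` if `b` ends up unmatched). -/
def Vpay (P : Pref A B) (E : Economy A B) (m : PreMatching A B) (t : ℕ) (b : B) : ℝ :=
  match m.mB (E.T - 1) b with
  | none => 0
  | some a => P.dB b ^ (matchTimeB E m t b - t) * P.v a b

/-- A family of conjectures `Φ`: for every period `t`, history `m^{t-1}` and agent `k`,
a set `φ_t(m^{t-1},k)` of matchings `k` considers possible upon remaining unmatched. -/
abbrev ConjFam (A B : Type) := ℕ → PreMatching A B → Agent A B → Set (PreMatching A B)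

/-- Validity of a family of conjectures for `E`: conjectures are (nonempty) subsets of
`M_T(m^{t-1},k)` and depend on the matching only through the history `m^{t-1}`. -/
def ConjFam.Valid (E : Economy A B) (φ : ConjFam A B) : Prop :=
  (∀ t m k, φ t m k ⊆ MSet E m t k) ∧
  (∀ t m m' k, agreeUpTo m m' t → φ t m k = φ t m' k) ∧
  (∀ t m k, t < E.T → IsMatching E m → isAvail E m t k → (φ t m k).Nonempty)

/-- `m` is a `Φ`-solution for `E` (Definition 3): in every period, every available agent
weakly prefers `m` to some conjectured matching, and no available pair blocks. -/
def IsSolution (P : Pref A B) (E : Economy A B) (φ : ConjFam A B)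
    (m : PreMatching A B) : Prop :=
  IsMatching E m ∧
  ∀ t, t < E.T →
    ((∀ a ∈ availA E m t, ∃ m' ∈ φ t m (Sum.inl a), Upay P E m' t a ≤ Upay P E m t a) ∧
     (∀ b ∈ availB E m t, ∃ m' ∈ φ t m (Sum.inr b), Vpay P E m' t b ≤ Vpay P E m t b) ∧
     (∀ a ∈ availA E m t, ∀ b ∈ availB E m t,
        ¬(P.u a b > Upay P E m t a ∧ P.v a b > Vpay P E m t b)))

/-- `Σ^Φ_T(E)`: the set of `Φ`-solutions of `E`. -/
def SolSet (P : Pref A B) (E : Economy A B) (φ : ConjFam A B) : Set (PreMatching A B) :=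
  {m | IsSolution P E φ m}

/-- The static (Gale–Shapley) notion of stability, for length-1 economies:
individual rationality plus absence of blocking pairs. -/
def Stable1 (P : Pref A B) (E : Economy A B) (m : PreMatching A B) : Prop :=
  IsMatching E m ∧
  (∀ a b, m.mA (E.T - 1) a = some b → 0 ≤ P.u a b) ∧
  (∀ b a, m.mB (E.T - 1) b = some a → 0 ≤ P.v a b) ∧
  (∀ a ∈ E.arrA 0, ∀ b ∈ E.arrB 0,
     ¬(P.u a b > Upay P E m 0 a ∧ P.v a b > Vpay P E m 0 b))

/-- The worst (minimal) period-`t` payoff of `a` over the set `C (inl a)` of matchings. -/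
def wA (P : Pref A B) (E : Economy A B) (t : ℕ)
    (C : Agent A B → Set (PreMatching A B)) (a : A) : ℝ :=
  sInf ((fun m' => Upay P E m' t a) '' C (Sum.inl a))

/-- The worst (minimal) period-`t` payoff of `b` over the set `C (inr b)` of matchings. -/
def wB (P : Pref A B) (E : Economy A B) (t : ℕ)
    (C : Agent A B → Set (PreMatching A B)) (b : B) : ℝ :=
  sInf ((fun m' => Vpay P E m' t b) '' C (Sum.inr b))

/-- Utility of side-`A` agent `a` in the induced one-period economy with outside
option value `W a` (truncated preferences). -/
def indU (P : Pref A B) (W : A → ℝ) (a : A) : Option B → ℝ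
  | none => W a
  | some b => P.u a b

/-- Utility of side-`B` agent `b` in the induced one-period economy with outside
option value `W b` (truncated preferences). -/
def indV (P : Pref A B) (W : B → ℝ) (b : B) : Option A → ℝ
  | none => W b
  | some a => P.v a b

/-- The period-`t` component of `mbar` is a stable matching of the one-period economy
`E_{t,φ}(m^{t-1})` induced by the conjecture profile `C` (Definition 6): matching among
the available agents, individually rational w.r.t. the worst-conjecture thresholds,
and without blocking pairs in the truncated preferences. -/
def StableInduced (P : Pref A B) (E : Economy A B) (m : PreMatching A B) (t : ℕ)
    (C : Agent A B → Set (PreMatching A B)) (mbar : PreMatching A B) : Prop :=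
  (∀ a ∈ availA E m t, ∀ b, mbar.mA t a = some b → b ∈ availB E m t ∧ mbar.mB t b = some a) ∧
  (∀ b ∈ availB E m t, ∀ a, mbar.mB t b = some a → a ∈ availA E m t ∧ mbar.mA t a = some b) ∧
  (∀ a ∈ availA E m t, ∀ b, mbar.mA t a = some b → wA P E t C a ≤ P.u a b) ∧
  (∀ b ∈ availB E m t, ∀ a, mbar.mB t b = some a → wB P E t C b ≤ P.v a b) ∧
  (∀ a ∈ availA E m t, ∀ b ∈ availB E m t,
     ¬(P.u a b > indU P (wA P E t C) a (mbar.mA t a) ∧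
       P.v a b > indV P (wB P E t C) b (mbar.mB t b)))

/-- `mbar_t` is stable among those who match in period `t` relative to the conjecture
profile `C` (Definition 7): every available agent matched in period `t` weakly prefers
its partner to its worst conjectured matching, and no pair of agents both matched in
period `t` blocks. -/
def StableAmongMatched (P : Pref A B) (E : Economy A B) (m : PreMatching A B) (t : ℕ)
    (C : Agent A B → Set (PreMatching A B)) (mbar : PreMatching A B) : Prop :=
  (∀ a ∈ availA E m t, ∀ b, mbar.mA t a = some b → wA P E t C a ≤ P.u a b) ∧
  (∀ b ∈ availB E m t, ∀ a, mbar.mB t b = some a → wB P E t C b ≤ P.v a b) ∧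
  (∀ a ∈ availA E m t, ∀ b ∈ availB E m t, ∀ b' a',
     mbar.mA t a = some b' → mbar.mB t b = some a' →
     ¬(P.u a b > P.u a b' ∧ P.v a b > P.v a' b))

/-- `E_t^T(m^{t-1})`: the continuation economy starting at period `t` given history `m`:
its first-period arrivals are the agents available at `t`, later arrivals are unchanged. -/
def contEconomy (E : Economy A B) (m : PreMatching A B) (t : ℕ) : Economy A B where
  T := E.T - t
  arrA := fun s => if s = 0 then availA E m t else E.arrA (t + s)
  arrB := fun s => if s = 0 then availB E m t else E.arrB (t + s)

/-- The restriction of `m` to the continuation economy starting in period `t`: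
time is shifted by `t` and agents matched strictly before `t` are dropped. -/
def restrictM (m : PreMatching A B) (t : ℕ) : PreMatching A B where
  mA := fun s a => if ∀ s', s' < t → m.mA s' a = none then m.mA (t + s) a else none
  mB := fun s b => if ∀ s', s' < t → m.mB s' b = none then m.mB (t + s) b else none

/-- The matching of the original economy corresponding to history `m` through period
`t-1` followed by the continuation matching `m'` (indexed from `0`) of the
continuation economy. -/
def splice (m m' : PreMatching A B) (t : ℕ) : PreMatching A B where
  mA := fun s a => if s < t then m.mA s a
    else if ∀ s', s' < t → m.mA s' a = none then m'.mA (s - t) a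
    else m.mA (t - 1) a
  mB := fun s b => if s < t then m.mB s b
    else if ∀ s', s' < t → m.mB s' b = none then m'.mB (s - t) b
    else m.mB (t - 1) b

/-- The family of conjectures that the family `φ` of the original economy induces on the
continuation economy `E_t^T(m^{t-1})`: at a continuation history, it is the (restriction
of the) original conjectures at the corresponding original history. -/
def contConj (E : Economy A B) (φ : ConjFam A B) (m : PreMatching A B) (t : ℕ) :
    ConjFam A B :=
  fun s mbar k => (fun m' => restrictM m' t) '' φ (t + s) (splice m mbar t) k

/-- The conjectures of eq. (2): the agent only rules out continuation matchings that do
not conform with the solution concept `S` from tomorrow onward. -/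
def starConj (S : Economy A B → Set (PreMatching A B)) (E : Economy A B) : ConjFam A B :=
  fun t m k =>
    {m' | m' ∈ MSet E m t k ∧ restrictM m' (t+1) ∈ S (contEconomy E m' (t+1))}

/-- `S` is the solution correspondence `Σ*` recursively generated by the conjectures of
eq. (2): stability for one-period economies, `Φ*`-solutions for longer economies
(empty continuations impose no restriction). -/
def IsStarFamily (P : Pref A B) (S : Economy A B → Set (PreMatching A B)) : Prop :=
  (∀ E : Economy A B, E.T = 0 → S E = Set.univ) ∧
  (∀ E : Economy A B, E.T = 1 → S E = {m | Stable1 P E m}) ∧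
  (∀ E : Economy A B, 2 ≤ E.T → S E = SolSet P E (starConj S E))

/-- The decreasing recursion defining the CVR conjectures at period `t`, history `m`,
relative to the continuation solution correspondence `DS`. -/
def cvrIter (P : Pref A B) (E : Economy A B)
    (DS : Economy A B → Set (PreMatching A B)) (t : ℕ) (m : PreMatching A B) :
    ℕ → Agent A B → Set (PreMatching A B)
  | 0 => fun k => MSet E m t k
  | n+1 => fun k =>
      {mbar | mbar ∈ MSet E m t k ∧
        StableAmongMatched P E m t (cvrIter P E DS t m n) mbar ∧
        restrictM mbar (t+1) ∈ DS (contEconomy E mbar (t+1))}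

/-- The CVR conjectures `φ_{D̂S,t}(m^{t-1},·)`: the limit (intersection) of the
decreasing recursion `cvrIter`. -/
def cvrConj (P : Pref A B) (DS : Economy A B → Set (PreMatching A B))
    (E : Economy A B) : ConjFam A B :=
  fun t m k => ⋂ n, cvrIter P E DS t m n k

/-- `DS` is the CVR-dynamic-stability correspondence `D̂S`: stable matchings for
one-period economies, `Φ_{D̂S}`-solutions for longer economies. -/
def IsCVRFamily (P : Pref A B) (DS : Economy A B → Set (PreMatching A B)) : Prop :=
  (∀ E : Economy A B, E.T = 0 → DS E = Set.univ) ∧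
  (∀ E : Economy A B, E.T = 1 → DS E = {m | Stable1 P E m}) ∧
  (∀ E : Economy A B, 2 ≤ E.T → DS E = SolSet P E (cvrConj P DS E))

/-- The dynamic-stability conjectures of Doval (2022): the period-`t` matching is stable
among those who match relative to individually rational continuation values, and the
continuation is dynamically stable. -/
def dsConj (P : Pref A B) (DSol : Economy A B → Set (PreMatching A B))
    (E : Economy A B) : ConjFam A B :=
  fun t m k =>
    {mbar | mbar ∈ MSet E m t k ∧
      (∀ a ∈ availA E m t, ∀ b, mbar.mA t a = some b → 0 ≤ P.u a b) ∧
      (∀ b ∈ availB E m t, ∀ a, mbar.mB t b = some a → 0 ≤ P.v a b) ∧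
      (∀ a ∈ availA E m t, ∀ b ∈ availB E m t, ∀ b' a',
         mbar.mA t a = some b' → mbar.mB t b = some a' →
         ¬(P.u a b > P.u a b' ∧ P.v a b > P.v a' b)) ∧
      restrictM mbar (t+1) ∈ DSol (contEconomy E mbar (t+1))}

/-- `DSol` is the dynamic-stability correspondence `DS` of Doval (2022). -/
def IsDSFamily (P : Pref A B) (DSol : Economy A B → Set (PreMatching A B)) : Prop :=
  (∀ E : Economy A B, E.T = 0 → DSol E = Set.univ) ∧
  (∀ E : Economy A B, E.T = 1 → DSol E = {m | Stable1 P E m}) ∧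
  (∀ E : Economy A B, 2 ≤ E.T → DSol E = SolSet P E (dsConj P DSol E))

/-- `E_{\k}`: the economy identical to `E` except that agent `k`'s arrival is delayed
by one period (from period `0` to period `1`). -/
def delayEconomy (E : Economy A B) : Agent A B → Economy A B
  | Sum.inl a =>
      { T := E.T
        arrA := fun s => if s = 0 then E.arrA 0 \ {a}
                 else if s = 1 then insert a (E.arrA 1) else E.arrA s
        arrB := E.arrB }
  | Sum.inr b =>
      { T := E.T
        arrA := E.arrA
        arrB := fun s => if s = 0 then E.arrB 0 \ {b}
                 else if s = 1 then insert b (E.arrB 1) else E.arrB s }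

/-- The candidate set `M*(m^{t-1}, C, Scont)`: matchings whose period-`t` matching is
stable in the one-period economy induced by the continuation-value sets `C`, and whose
continuation lies in `Scont` of the induced continuation economy. -/
def candT (P : Pref A B) (Scont : Economy A B → Set (PreMatching A B))
    (E : Economy A B) (t : ℕ) (m : PreMatching A B)
    (C : Agent A B → Set (PreMatching A B)) : Set (PreMatching A B) :=
  {mbar | mbar ∈ MSetH E m t ∧ StableInduced P E m t C mbar ∧
    restrictM mbar (t+1) ∈ Scont (contEconomy E mbar (t+1))}

/-- The increasing recursion `F_n` defining the sophisticated-dynamic-stability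
conjectures at period `t`, history `m`, relative to the correspondence `SDS` on
strictly shorter problems. -/
def sdsF (P : Pref A B) (SDS : Economy A B → Set (PreMatching A B))
    (E : Economy A B) (t : ℕ) (m : PreMatching A B) :
    ℕ → Agent A B → Set (PreMatching A B)
  | 0 => fun k =>
      {mbar | mbar ∈ MSet E m t k ∧
        restrictM mbar t ∈ SDS (delayEconomy (contEconomy E m t) k)}
  | n+1 => fun k => sdsF P SDS E t m n k ∪
      {mbar | mbar ∈ candT P SDS E t m (sdsF P SDS E t m n) ∧ unmatchedAt mbar t k}

/-- The SDS conjectures `φ_{SDS,t}`: the limit (union) of the increasing recursion `F_n`. -/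
def sdsConj (P : Pref A B) (SDS : Economy A B → Set (PreMatching A B))
    (E : Economy A B) : ConjFam A B :=
  fun t m k => ⋃ n, sdsF P SDS E t m n k

/-- `SDS` is the sophisticated-dynamic-stability correspondence. -/
def IsSDSFamily (P : Pref A B) (SDS : Economy A B → Set (PreMatching A B)) : Prop :=
  (∀ E : Economy A B, E.T = 0 → SDS E = Set.univ) ∧
  (∀ E : Economy A B, E.T = 1 → SDS E = {m | Stable1 P E m}) ∧
  (∀ E : Economy A B, 2 ≤ E.T → SDS E = SolSet P E (sdsConj P SDS E))

/-- The rational-expectations conjectures: `k` conjectures exactly the `RE` solutions of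
the continuation economy in which `k`'s arrival is delayed by one period. -/
def reConj (RE : Economy A B → Set (PreMatching A B)) (E : Economy A B) : ConjFam A B :=
  fun t m k =>
    {mbar | mbar ∈ MSet E m t k ∧
      restrictM mbar t ∈ RE (delayEconomy (contEconomy E m t) k)}

/-- `RE` is the rational-expectations solution correspondence. -/
def IsREFamily (P : Pref A B) (RE : Economy A B → Set (PreMatching A B)) : Prop :=
  (∀ E : Economy A B, E.T = 1 → RE E = {m | Stable1 P E m}) ∧
  (∀ E : Economy A B, 2 ≤ E.T → RE E = SolSet P E (reConj RE E))


/-! ### The Example-1 economy.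
Side-`A` agents `a1,…,a4` are `0,…,3 : Fin 4`; side-`B` agents `b1,…,b4` are
`0,…,3 : Fin 4`. Arrivals: `A_1 = {a1,a2,a3}`, `B_1 = {b1,b2}`, `A_2 = {a4}`,
`B_2 = {b3,b4}`. -/

/-- The Example-1 economy. -/
def E1 : Economy (Fin 4) (Fin 4) where
  T := 2
  arrA := fun s => if s = 0 then {0, 1, 2} else if s = 1 then {3} else ∅
  arrB := fun s => if s = 0 then {0, 1} else if s = 1 then {2, 3} else ∅

/-- `P` realizes the strict rankings of discounted payoffs of Example 1
(unlisted partners are unacceptable, i.e. have negative utility; `a2` and `b1`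
have discount factors below but close enough to `1` that a better static partner is
preferred regardless of timing). -/
def Ex1Pref (P : Pref (Fin 4) (Fin 4)) : Prop :=
  P.Valid ∧
  -- a1: (b4,0) ≻ (b2,0) ≻ (b1,0) ≻ (b4,1) ≻ all else
  (P.u 0 3 > P.u 0 1 ∧ P.u 0 1 > P.u 0 0 ∧ P.u 0 0 > P.dA 0 * P.u 0 3 ∧
    P.dA 0 * P.u 0 3 > P.dA 0 * P.u 0 1 ∧ P.dA 0 * P.u 0 3 > P.dA 0 * P.u 0 0 ∧
    P.dA 0 * P.u 0 3 > P.u 0 2 ∧ P.dA 0 * P.u 0 3 > P.dA 0 * P.u 0 2 ∧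
    P.dA 0 * P.u 0 3 > 0 ∧ P.u 0 2 < 0) ∧
  -- a2: b3 ≻ b4 ≻ b2 ≻ b1, δ close to 1
  (P.dA 1 < 1 ∧ (∀ j j' : Fin 4, P.u 1 j > P.u 1 j' → P.dA 1 * P.u 1 j > P.u 1 j') ∧
    P.u 1 2 > P.u 1 3 ∧ P.u 1 3 > P.u 1 1 ∧ P.u 1 1 > P.u 1 0 ∧ P.u 1 0 > 0) ∧
  -- a3: (b3,0) ≻ (b2,0) ≻ (b3,1) ≻ all else
  (P.u 2 2 > P.u 2 1 ∧ P.u 2 1 > P.dA 2 * P.u 2 2 ∧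
    P.dA 2 * P.u 2 2 > P.dA 2 * P.u 2 1 ∧ P.dA 2 * P.u 2 2 > P.u 2 0 ∧
    P.dA 2 * P.u 2 2 > P.dA 2 * P.u 2 0 ∧ P.dA 2 * P.u 2 2 > P.u 2 3 ∧
    P.dA 2 * P.u 2 2 > P.dA 2 * P.u 2 3 ∧ P.dA 2 * P.u 2 2 > 0 ∧
    P.u 2 0 < 0 ∧ P.u 2 3 < 0) ∧
  -- a4: b3 ≻ b1 ≻ b4, b2 unacceptable
  (P.u 3 2 > P.u 3 0 ∧ P.u 3 0 > P.u 3 3 ∧ P.u 3 3 > 0 ∧ P.u 3 1 < 0) ∧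
  -- b1: a4 ≻ a1 ≻ a2, δ close to 1, a3 unacceptable
  (P.dB 0 < 1 ∧ (∀ i i' : Fin 4, P.v i 0 > P.v i' 0 → P.dB 0 * P.v i 0 > P.v i' 0) ∧
    P.v 3 0 > P.v 0 0 ∧ P.v 0 0 > P.v 1 0 ∧ P.v 1 0 > 0 ∧ P.v 2 0 < 0) ∧
  -- b2: (a2,0) ≻ (a2,1) ≻ (a3,0) ≻ (a1,0) ≻ (a3,1) ≻ all else
  (P.v 1 1 > P.dB 1 * P.v 1 1 ∧ P.dB 1 * P.v 1 1 > P.v 2 1 ∧ P.v 2 1 > P.v 0 1 ∧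
    P.v 0 1 > P.dB 1 * P.v 2 1 ∧ P.dB 1 * P.v 2 1 > P.dB 1 * P.v 0 1 ∧
    P.dB 1 * P.v 2 1 > P.v 3 1 ∧ P.dB 1 * P.v 2 1 > P.dB 1 * P.v 3 1 ∧
    P.dB 1 * P.v 2 1 > 0 ∧ P.v 3 1 < 0) ∧
  -- b3: a3 ≻ a4 ≻ a2, a1 unacceptable
  (P.v 2 2 > P.v 3 2 ∧ P.v 3 2 > P.v 1 2 ∧ P.v 1 2 > 0 ∧ P.v 0 2 < 0) ∧
  -- b4: a4 ≻ a2 ≻ a1, a3 unacceptable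
  (P.v 3 3 > P.v 1 3 ∧ P.v 1 3 > P.v 0 3 ∧ P.v 0 3 > 0 ∧ P.v 2 3 < 0)

/-- The candidate matching `m*`: `a1–b1`, `a2–b2` in period 1; `a3–b3`, `a4–b4` in
period 2. -/
def mstar1 : PreMatching (Fin 4) (Fin 4) where
  mA := fun t a => if t = 0 then (if a = 0 ∨ a = 1 then some a else none) else some a
  mB := fun t b => if t = 0 then (if b = 0 ∨ b = 1 then some b else none) else some b

/-- The matching `m_{a2}`: `a1–b1` in period 1; `a2–b2`, `a3–b3`, `a4–b4` in period 2. -/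
def ma2 : PreMatching (Fin 4) (Fin 4) where
  mA := fun t a => if t = 0 then (if a = 0 then some 0 else none) else some a
  mB := fun t b => if t = 0 then (if b = 0 then some 0 else none) else some b

/-- The matching `m_{b1}`: `a3–b2` in period 1; `a1–b1`, `a2–b4`, `a4–b3` in period 2. -/
def mb1 : PreMatching (Fin 4) (Fin 4) where
  mA := fun t a => if t = 0 then (if a = 2 then some 1 else none)
    else (if a = 0 then some 0 else if a = 1 then some 3 else
          if a = 2 then some 1 else some 2)
  mB := fun t b => if t = 0 then (if b = 1 then some 2 else none)
    else (if b = 0 then some 0 else if b = 1 then some 2 else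
          if b = 2 then some 3 else some 1)

/-- The fate of an agent: unmatched, or matched to a partner, the flag telling whether the
match is formed only in the second period. -/
abbrev Slot := Option (Fin 4 × Bool)

/-- The partner at period `t`. -/
def Slot.at (t : ℕ) : Slot → Option (Fin 4)
  | none => none
  | some (j, late) => if late = true ∧ t = 0 then none else some j

/-- The slot as seen from the second period. -/
def Slot.now : Slot → Slot
  | none => none
  | some (j, _) => some (j, false)

/-- The discounted value of a slot. -/
def Slot.val (d : ℝ) (u : Fin 4 → ℝ) : Slot → ℝ
  | none => 0
  | some (j, false) => u j
  | some (j, true) => d * u j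

/-- The dynamic matching in which every agent obtains its slot. -/
def planM (p q : Fin 4 → Slot) : PreMatching (Fin 4) (Fin 4) :=
  ⟨fun t a => Slot.at t (p a), fun t b => Slot.at t (q b)⟩

/-- The length-2 economy with first-period arrivals `S` and `R`, everybody else arriving
in the second period. -/
def econ (S R : Finset (Fin 4)) : Economy (Fin 4) (Fin 4) where
  T := 2
  arrA := fun s => if s = 0 then S else if s = 1 then Sᶜ else ∅
  arrB := fun s => if s = 0 then R else if s = 1 then Rᶜ else ∅

/-- The slots on the two sides match up, and early matches involve early arrivals. -/
def Consistent (S R : Finset (Fin 4)) (p q : Fin 4 → Slot) : Prop :=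
  (∀ a b l, p a = some (b, l) ↔ q b = some (a, l)) ∧
  (∀ a b, p a = some (b, false) → a ∈ S ∧ b ∈ R)

instance (S R : Finset (Fin 4)) (p q : Fin 4 → Slot) : Decidable (Consistent S R p q) :=
  inferInstanceAs (Decidable (_ ∧ _))

/-- `y` is listed in the descending ranking `L`, and not after `x`. -/
def RankLe (L : List Slot) (x y : Slot) : Prop := y ∈ L ∧ L.idxOf y ≤ L.idxOf x

instance (L : List Slot) (x y : Slot) : Decidable (RankLe L x y) :=
  inferInstanceAs (Decidable (_ ∧ _))

/-- Acceptable slots of the side-`A` agents, best first. -/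
def rankA : Fin 4 → List Slot :=
  ![[some (3, false), some (1, false), some (0, false), some (3, true), some (1, true),
      some (0, true), none],
    [some (2, false), some (2, true), some (3, false), some (3, true), some (1, false),
      some (1, true), some (0, false), some (0, true), none],
    [some (2, false), some (1, false), some (2, true), some (1, true), none],
    [some (2, false), some (0, false), some (3, false), none]]

/-- Acceptable slots of the side-`B` agents, best first. -/
def rankB : Fin 4 → List Slot :=
  ![[some (3, false), some (3, true), some (0, false), some (0, true), some (1, false),
      some (1, true), none],
    [some (1, false), some (1, true), some (2, false), some (0, false), some (2, true),
      some (0, true), none],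
    [some (2, false), some (3, false), some (1, false), none],
    [some (3, false), some (1, false), some (0, false), none]]

theorem val_le_of_rankLe {d : ℝ} {u : Fin 4 → ℝ} {L : List Slot} {x y : Slot}
    (hL : L.IsChain fun z w => Slot.val d u w ≤ Slot.val d u z)
    (h0 : ∀ z ∈ L, 0 ≤ Slot.val d u z)
    (hx : x ∉ L → Slot.val d u x ≤ 0) (h : RankLe L x y) :
    Slot.val d u x ≤ Slot.val d u y := by
  have : IsTrans Slot fun z w => Slot.val d u w ≤ Slot.val d u z :=
    ⟨fun _ _ _ h₁ h₂ => h₂.trans h₁⟩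
  by_cases hxL : x ∈ L
  · rcases h.2.eq_or_lt with he | hlt
    · rw [(List.idxOf_inj h.1).1 he]
    · have h1 := List.idxOf_lt_length_of_mem h.1
      have h2 := List.idxOf_lt_length_of_mem hxL
      simpa using List.pairwise_iff_getElem.1 hL.pairwise _ _ h1 h2 hlt
  · exact (hx hxL).trans (h0 y h.1)

theorem rankA_sound {P : Pref (Fin 4) (Fin 4)} (hP : Ex1Pref P) (a : Fin 4) {x y : Slot}
    (hx : a ≠ 3 ∨ x.now = x) (h : RankLe (rankA a) x y) :
    Slot.val (P.dA a) (P.u a) x ≤ Slot.val (P.dA a) (P.u a) y := by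
  obtain ⟨⟨hd, -⟩, h1, h2, h3, h4, -⟩ := hP
  obtain ⟨hd0, hd1⟩ := hd a
  have hlow : ∀ j, 0 ≤ P.u a j → 0 ≤ P.dA a * P.u a j ∧ P.dA a * P.u a j ≤ P.u a j :=
    fun j hj => ⟨mul_nonneg hd0 hj, mul_le_of_le_one_left hj hd1⟩
  have hneg : ∀ j, P.u a j < 0 → P.dA a * P.u a j ≤ 0 :=
    fun j hj => mul_nonpos_of_nonneg_of_nonpos hd0 hj.le
  have hmono : ∀ i j, P.u a i < P.u a j → P.dA a * P.u a i ≤ P.dA a * P.u a j :=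
    fun i j hj => mul_le_mul_of_nonneg_left hj.le hd0
  refine val_le_of_rankLe ?_ ?_ ?_ h
  · fin_cases a <;> simp [rankA, Slot.val] at *
    · have := hmono 0 1 (by linarith)
      have := hlow 0 (by linarith)
      refine ⟨?_, ?_, ?_, ?_, ?_, ?_⟩ <;> linarith
    · obtain ⟨_, hc, _⟩ := h2
      have := hlow 0 (by linarith)
      have := hlow 1 (by linarith)
      have := hlow 2 (by linarith)
      have := hlow 3 (by linarith)
      have := hc 2 3 (by linarith)
      have := hc 3 1 (by linarith)
      have := hc 1 0 (by linarith)
      refine ⟨?_, ?_, ?_, ?_, ?_, ?_, ?_, ?_⟩ <;> linarith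
    · have := hlow 1 (by linarith)
      refine ⟨?_, ?_, ?_, ?_⟩ <;> linarith
    · refine ⟨?_, ?_, ?_⟩ <;> linarith
  · fin_cases a <;> simp [rankA, Slot.val] at *
    · have := hlow 0 (by linarith)
      have := hlow 1 (by linarith)
      refine ⟨?_, ?_, ?_, ?_, ?_, ?_⟩ <;> linarith
    · have := hlow 0 (by linarith)
      have := hlow 1 (by linarith)
      have := hlow 2 (by linarith)
      have := hlow 3 (by linarith)
      refine ⟨?_, ?_, ?_, ?_, ?_, ?_, ?_, ?_⟩ <;> linarith
    · have := hlow 1 (by linarith)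
      refine ⟨?_, ?_, ?_, ?_⟩ <;> linarith
    · refine ⟨?_, ?_, ?_⟩ <;> linarith
  · intro hxL
    rcases x with _ | ⟨j, l⟩
    · exact le_rfl
    · have hu : P.u a j < 0 := by
        have hbad : (a, j) ∈ ([(0, 2), (2, 0), (2, 3), (3, 1)] : List (Fin 4 × Fin 4)) := by
          clear * - hx hxL
          revert a j l
          decide
        simp only [List.mem_cons, Prod.mk.injEq, List.not_mem_nil, or_false] at hbad
        rcases hbad with ⟨rfl, rfl⟩ | ⟨rfl, rfl⟩ | ⟨rfl, rfl⟩ | ⟨rfl, rfl⟩ <;> linarith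
      cases l
      exacts [hu.le, hneg j hu]

theorem rankB_sound {P : Pref (Fin 4) (Fin 4)} (hP : Ex1Pref P) (b : Fin 4) {x y : Slot}
    (hx : b < 2 ∨ x.now = x) (h : RankLe (rankB b) x y) :
    Slot.val (P.dB b) (P.v · b) x ≤ Slot.val (P.dB b) (P.v · b) y := by
  obtain ⟨⟨-, hd⟩, -, -, -, -, h1, h2, h3, h4⟩ := hP
  obtain ⟨hd0, hd1⟩ := hd b
  have hlow : ∀ j, 0 ≤ P.v j b → 0 ≤ P.dB b * P.v j b ∧ P.dB b * P.v j b ≤ P.v j b :=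
    fun j hj => ⟨mul_nonneg hd0 hj, mul_le_of_le_one_left hj hd1⟩
  have hneg : ∀ j, P.v j b < 0 → P.dB b * P.v j b ≤ 0 :=
    fun j hj => mul_nonpos_of_nonneg_of_nonpos hd0 hj.le
  refine val_le_of_rankLe ?_ ?_ ?_ h
  · fin_cases b <;> simp [rankB, Slot.val] at *
    · obtain ⟨_, hc, _⟩ := h1
      have := hlow 0 (by linarith)
      have := hlow 1 (by linarith)
      have := hlow 3 (by linarith)
      have := hc 3 0 (by linarith)
      have := hc 0 1 (by linarith)
      refine ⟨?_, ?_, ?_, ?_, ?_, ?_⟩ <;> linarith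
    · have := hlow 0 (by linarith)
      refine ⟨?_, ?_, ?_, ?_, ?_, ?_⟩ <;> linarith
    · refine ⟨?_, ?_, ?_⟩ <;> linarith
    · refine ⟨?_, ?_, ?_⟩ <;> linarith
  · fin_cases b <;> simp [rankB, Slot.val] at *
    · have := hlow 0 (by linarith)
      have := hlow 1 (by linarith)
      have := hlow 3 (by linarith)
      refine ⟨?_, ?_, ?_, ?_, ?_, ?_⟩ <;> linarith
    · have := hlow 0 (by linarith)
      refine ⟨?_, ?_, ?_, ?_, ?_, ?_⟩ <;> linarith
    · refine ⟨?_, ?_, ?_⟩ <;> linarith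
    · refine ⟨?_, ?_, ?_⟩ <;> linarith
  · intro hxL
    rcases x with _ | ⟨j, l⟩
    · exact le_rfl
    · have hu : P.v j b < 0 := by
        have hbad : (b, j) ∈ ([(0, 2), (1, 3), (2, 0), (3, 2)] : List (Fin 4 × Fin 4)) := by
          clear * - hx hxL
          revert b j l
          decide
        simp only [List.mem_cons, Prod.mk.injEq, List.not_mem_nil, or_false] at hbad
        rcases hbad with ⟨rfl, rfl⟩ | ⟨rfl, rfl⟩ | ⟨rfl, rfl⟩ | ⟨rfl, rfl⟩ <;> linarith
      cases l
      exacts [hu.le, hneg j hu]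

theorem arrAUpTo_zero (E : Economy (Fin 4) (Fin 4)) : arrAUpTo E 0 = E.arrA 0 := by
  simp [arrAUpTo]

theorem arrBUpTo_zero (E : Economy (Fin 4) (Fin 4)) : arrBUpTo E 0 = E.arrB 0 := by
  simp [arrBUpTo]

theorem arrAUpTo_econ_one (S R : Finset (Fin 4)) (a : Fin 4) : a ∈ arrAUpTo (econ S R) 1 := by
  by_cases h : a ∈ S
  · exact Finset.mem_biUnion.2 ⟨0, by simp, by simpa [econ] using h⟩
  · exact Finset.mem_biUnion.2 ⟨1, by simp, by simpa [econ] using h⟩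

theorem arrBUpTo_econ_one (S R : Finset (Fin 4)) (b : Fin 4) : b ∈ arrBUpTo (econ S R) 1 := by
  by_cases h : b ∈ R
  · exact Finset.mem_biUnion.2 ⟨0, by simp, by simpa [econ] using h⟩
  · exact Finset.mem_biUnion.2 ⟨1, by simp, by simpa [econ] using h⟩

theorem Slot.at_eq_some {t : ℕ} {x : Slot} {j : Fin 4} :
    x.at t = some j ↔ ∃ l, x = some (j, l) ∧ ¬(l = true ∧ t = 0) := by
  rcases x with _ | ⟨i, l⟩
  · simp [Slot.at]
  · cases l <;> simp [Slot.at, eq_comm, and_comm]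

theorem Slot.at_zero_eq_some {x : Slot} {j : Fin 4} :
    x.at 0 = some j ↔ x = some (j, false) := by
  simp [Slot.at_eq_some]

theorem Slot.at_zero_eq_none {x : Slot} :
    x.at 0 = none ↔ ∀ j, x ≠ some (j, false) := by
  rw [Option.eq_none_iff_forall_ne_some]
  exact forall_congr' fun j => not_congr Slot.at_zero_eq_some

theorem Slot.at_mono {t s : ℕ} (hts : t ≤ s) {x : Slot} (h : x.at t ≠ none) :
    x.at s = x.at t := by
  obtain ⟨j, hj⟩ := Option.ne_none_iff_exists'.1 h
  obtain ⟨l, hl, hn⟩ := Slot.at_eq_some.1 hj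
  rw [hj]
  exact Slot.at_eq_some.2 ⟨l, hl, fun h' => hn ⟨h'.1, by omega⟩⟩

theorem isMatching_planM {S R : Finset (Fin 4)} {p q : Fin 4 → Slot}
    (h : Consistent S R p q) : IsMatching (econ S R) (planM p q) := by
  refine ⟨fun t a b _ => ?_, fun t a ht hne => ?_, fun t a b ht hab => ?_,
    fun t s a hts _ hne => Slot.at_mono hts hne, fun t s b hts _ hne => Slot.at_mono hts hne⟩
  · simp only [planM, Slot.at_eq_some, h.1]
  · obtain rfl | rfl : t = 0 ∨ t = 1 := by simp only [econ] at ht; omega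
    · obtain ⟨b, hb⟩ := Option.ne_none_iff_exists'.1 hne
      rw [arrAUpTo_zero]
      exact (h.2 a b (Slot.at_zero_eq_some.1 hb)).1
    · exact arrAUpTo_econ_one S R a
  · obtain rfl | rfl : t = 0 ∨ t = 1 := by simp only [econ] at ht; omega
    · rw [arrBUpTo_zero]
      exact (h.2 a b (Slot.at_zero_eq_some.1 hab)).2
    · exact arrBUpTo_econ_one S R b

theorem availA_zero (E : Economy (Fin 4) (Fin 4)) (m : PreMatching (Fin 4) (Fin 4)) :
    availA E m 0 = E.arrA 0 := by
  simp [availA, arrAUpTo]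

theorem availB_zero (E : Economy (Fin 4) (Fin 4)) (m : PreMatching (Fin 4) (Fin 4)) :
    availB E m 0 = E.arrB 0 := by
  simp [availB, arrBUpTo]

theorem sInf_matched_zero {x : Slot} :
    min (sInf {s | 0 ≤ s ∧ x.at s ≠ none}) 2 =
      match x with | none => min (sInf ∅) 2 | some (_, false) => 0 | some (_, true) => 1 := by
  rcases x with _ | ⟨j, _ | _⟩
  · simp [Slot.at]
  · simp [Slot.at]
  · have : {s : ℕ | 0 ≤ s ∧ Slot.at s (some (j, true)) ≠ none} = Set.Ici 1 := by
      ext s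
      simp [Slot.at, Nat.one_le_iff_ne_zero]
    rw [this, csInf_Ici]
    rfl

theorem sInf_matched_one {x : Slot} (h : x ≠ none) :
    min (sInf {s | 1 ≤ s ∧ x.at s ≠ none}) 2 = 1 := by
  have : {s : ℕ | 1 ≤ s ∧ x.at s ≠ none} = Set.Ici 1 := by
    ext s
    rcases x with _ | ⟨j, l⟩
    · exact absurd rfl h
    · simp [Slot.at]
      omega
  rw [this, csInf_Ici]
  rfl

theorem Upay_zero (P : Pref (Fin 4) (Fin 4)) (S R : Finset (Fin 4)) (p q : Fin 4 → Slot)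
    (a : Fin 4) :
    Upay P (econ S R) (planM p q) 0 a = Slot.val (P.dA a) (P.u a) (p a) := by
  have h := @sInf_matched_zero (p a)
  simp only [Upay, matchTimeA, planM, econ] at h ⊢
  rw [h]
  rcases p a with _ | ⟨j, _ | _⟩ <;> simp [Slot.at, Slot.val]

theorem Vpay_zero (P : Pref (Fin 4) (Fin 4)) (S R : Finset (Fin 4)) (p q : Fin 4 → Slot)
    (b : Fin 4) :
    Vpay P (econ S R) (planM p q) 0 b = Slot.val (P.dB b) (P.v · b) (q b) := by
  have h := @sInf_matched_zero (q b)
  simp only [Vpay, matchTimeB, planM, econ] at h ⊢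
  rw [h]
  rcases q b with _ | ⟨j, _ | _⟩ <;> simp [Slot.at, Slot.val]

theorem Upay_one (P : Pref (Fin 4) (Fin 4)) (S R : Finset (Fin 4)) (p q : Fin 4 → Slot)
    (a : Fin 4) :
    Upay P (econ S R) (planM p q) 1 a = Slot.val (P.dA a) (P.u a) (p a).now := by
  have h := @sInf_matched_one (p a)
  simp only [Upay, matchTimeA, planM, econ] at h ⊢
  rcases hp : p a with _ | ⟨j, l⟩
  · simp [Slot.at, Slot.val, Slot.now]
  · rw [hp] at h
    rw [h (by simp)]
    simp [Slot.at, Slot.val, Slot.now]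

theorem Vpay_one (P : Pref (Fin 4) (Fin 4)) (S R : Finset (Fin 4)) (p q : Fin 4 → Slot)
    (b : Fin 4) :
    Vpay P (econ S R) (planM p q) 1 b = Slot.val (P.dB b) (P.v · b) (q b).now := by
  have h := @sInf_matched_one (q b)
  simp only [Vpay, matchTimeB, planM, econ] at h ⊢
  rcases hq : q b with _ | ⟨j, l⟩
  · simp [Slot.at, Slot.val, Slot.now]
  · rw [hq] at h
    rw [h (by simp)]
    simp [Slot.at, Slot.val, Slot.now]

/-- The slots of one side determined by those of the other side. -/
def partners (p : Fin 4 → Slot) (b : Fin 4) : Slot :=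
  (List.finRange 4).findSome? fun a =>
    match p a with
    | none => none
    | some (b', l) => if b' = b then some (a, l) else none

/-- The agents that are not matched early. -/
abbrev lateSet (p : Fin 4 → Slot) : Finset (Fin 4) :=
  Finset.univ.filter fun a => (p a).at 0 = none

/-- Seen from the second period, the slots are individually rational and without blocking pair
among the agents `X` and `Y`. -/
def StaticStable (X Y : Finset (Fin 4)) (p q : Fin 4 → Slot) : Prop :=
  (∀ a ∈ X, RankLe (rankA a) none (p a).now) ∧
  (∀ b ∈ Y, RankLe (rankB b) none (q b).now) ∧
  (∀ a ∈ X, ∀ b ∈ Y, RankLe (rankA a) (some (b, false)) (p a).now ∨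
    RankLe (rankB b) (some (a, false)) (q b).now)

instance (X Y : Finset (Fin 4)) (p q : Fin 4 → Slot) : Decidable (StaticStable X Y p q) :=
  inferInstanceAs (Decidable (_ ∧ _ ∧ _))

/-- `(p', q')` has the same early matches as `(p, q)`, and its late matches form a stable
matching between `X` and `Y`. -/
def StableCompletion (X Y : Finset (Fin 4)) (p q p' q' : Fin 4 → Slot) : Prop :=
  (∀ a, (p' a).at 0 = (p a).at 0) ∧ (∀ b, (q' b).at 0 = (q b).at 0) ∧
  (∀ a b l, p' a = some (b, l) ↔ q' b = some (a, l)) ∧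
  (∀ a b, p' a = some (b, true) → a ∈ X ∧ b ∈ Y) ∧
  StaticStable X Y p' q'

instance (X Y : Finset (Fin 4)) (p q p' q' : Fin 4 → Slot) :
    Decidable (StableCompletion X Y p q p' q') :=
  inferInstanceAs (Decidable (_ ∧ _ ∧ _ ∧ _ ∧ _))

/-- Deferred acceptance: the list holds the free proposers with their remaining proposals, and
the function the tentative acceptances. -/
def deferredAcceptance : ℕ → List (Fin 4 × List (Fin 4)) →
    (Fin 4 → Option (Fin 4 × List (Fin 4))) → Fin 4 → Option (Fin 4 × List (Fin 4))
  | 0, _, held => held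
  | _ + 1, [], held => held
  | n + 1, (_, []) :: free, held => deferredAcceptance n free held
  | n + 1, (a, b :: rest) :: free, held =>
    match held b with
    | none =>
      if some (a, false) ∈ rankB b then
        deferredAcceptance n free fun x => if x = b then some (a, rest) else held x
      else deferredAcceptance n ((a, rest) :: free) held
    | some (a', rest') =>
      if (rankB b).idxOf (some (a, false)) < (rankB b).idxOf (some (a', false)) then
        deferredAcceptance n ((a', rest') :: free) fun x => if x = b then some (a, rest) else held x
      else deferredAcceptance n ((a, rest) :: free) held

/-- The side-`B` slots keeping the early matches of `q` and adding late ones between `X` and `Y`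
by deferred acceptance. -/
def completion (X Y : Finset (Fin 4)) (q : Fin 4 → Slot) (b : Fin 4) : Slot :=
  match q b with
  | some (a, false) => some (a, false)
  | _ => (deferredAcceptance 24
      (((List.finRange 4).filter (· ∈ X)).map fun a => (a, (rankA a).filterMap fun s =>
        match s with
        | some (b, false) => if b ∈ Y then some b else none
        | _ => none)) (fun _ => none) b).map fun x => (x.1, true)

/-- Deferred acceptance among the late agents, less those in `X` and `Y`, gives a stable
completion. -/
def HasCompletion (p q : Fin 4 → Slot) (X Y : Finset (Fin 4)) : Prop :=
  StableCompletion (lateSet p \ X) (lateSet q \ Y) p q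
    (partners (completion (lateSet p \ X) (lateSet q \ Y) q))
    (completion (lateSet p \ X) (lateSet q \ Y) q)

instance (p q : Fin 4 → Slot) (X Y : Finset (Fin 4)) : Decidable (HasCompletion p q X Y) :=
  inferInstanceAs (Decidable (StableCompletion ..))

/-- The requirements on the second period of a solution. -/
def SecondPeriodOK (p q : Fin 4 → Slot) : Prop :=
  StaticStable (lateSet p) (lateSet q) p q ∧ (∀ a ∈ lateSet p, HasCompletion p q {a} ∅) ∧
    ∀ b ∈ lateSet q, HasCompletion p q ∅ {b}

instance (p q : Fin 4 → Slot) : Decidable (SecondPeriodOK p q) :=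
  inferInstanceAs (Decidable (_ ∧ _ ∧ _))

/-- All matches are formed in the second period. -/
def planLate : Fin 4 → Slot := ![some (1, true), some (3, true), some (2, true), some (0, true)]

/-- `a1–b2` is formed in the first period, the other matches in the second one. -/
def planA1 : Fin 4 → Slot := ![some (1, false), some (3, true), some (2, true), some (0, true)]

/-- `a3–b2` is formed in the first period, the other matches in the second one. -/
def planA3 : Fin 4 → Slot := ![some (0, true), some (3, true), some (1, false), some (2, true)]

/-- `a1–b1` and `a3–b2` are formed in the first period, the other matches in the second one. -/
def planA1A3 : Fin 4 → Slot := ![some (0, false), some (3, true), some (1, false), some (2, true)]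

/-- The slots of `ma2`. -/
def planMa2 : Fin 4 → Slot := ![some (0, false), some (1, true), some (2, true), some (3, true)]

theorem secondPeriodOK_planLate : SecondPeriodOK planLate (partners planLate) := by decide

theorem secondPeriodOK_planA1 : SecondPeriodOK planA1 (partners planA1) := by decide

theorem secondPeriodOK_planA3 : SecondPeriodOK planA3 (partners planA3) := by decide

theorem secondPeriodOK_planA1A3 : SecondPeriodOK planA1A3 (partners planA1A3) := by decide

theorem secondPeriodOK_planMa2 : SecondPeriodOK planMa2 (partners planMa2) := by decide

theorem restrictM_planM_mA {p q : Fin 4 → Slot} {a b : Fin 4} :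
    (restrictM (planM p q) 1).mA 0 a = some b ↔ p a = some (b, true) := by
  simp only [restrictM, planM, Nat.lt_one_iff, forall_eq]
  rcases p a with _ | ⟨j, _ | _⟩ <;> simp [Slot.at]

theorem restrictM_planM_mB {p q : Fin 4 → Slot} {a b : Fin 4} :
    (restrictM (planM p q) 1).mB 0 b = some a ↔ q b = some (a, true) := by
  simp only [restrictM, planM, Nat.lt_one_iff, forall_eq]
  rcases q b with _ | ⟨j, _ | _⟩ <;> simp [Slot.at]

theorem Upay_restrictM (P : Pref (Fin 4) (Fin 4)) {F : Economy (Fin 4) (Fin 4)} (hT : F.T = 1)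
    {p q : Fin 4 → Slot} {a : Fin 4} (ha : (p a).at 0 = none) :
    Upay P F (restrictM (planM p q) 1) 0 a = Slot.val (P.dA a) (P.u a) (p a).now := by
  have h : ∀ j, (restrictM (planM p q) 1).mA 0 a = some j ↔ p a = some (j, true) :=
    fun j => restrictM_planM_mA
  simp only [Upay, matchTimeA, hT, Nat.sub_self]
  rcases hp : p a with _ | ⟨j, _ | _⟩
  · have hn : (restrictM (planM p q) 1).mA 0 a = none :=
      Option.eq_none_iff_forall_ne_some.2 fun j hj => by simpa [hp] using (h j).1 hj
    rw [hn]
    rfl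
  · simp [hp, Slot.at] at ha
  · have hj := (h j).2 hp
    have h0 : sInf {s | 0 ≤ s ∧ (restrictM (planM p q) 1).mA s a ≠ none} = 0 :=
      Nat.sInf_eq_zero.2 (Or.inl ⟨le_rfl, by simp [hj]⟩)
    rw [hj, h0]
    simp [Slot.now, Slot.val]

theorem Vpay_restrictM (P : Pref (Fin 4) (Fin 4)) {F : Economy (Fin 4) (Fin 4)} (hT : F.T = 1)
    {p q : Fin 4 → Slot} {b : Fin 4} (hb : (q b).at 0 = none) :
    Vpay P F (restrictM (planM p q) 1) 0 b = Slot.val (P.dB b) (P.v · b) (q b).now := by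
  have h : ∀ i, (restrictM (planM p q) 1).mB 0 b = some i ↔ q b = some (i, true) :=
    fun i => restrictM_planM_mB
  simp only [Vpay, matchTimeB, hT, Nat.sub_self]
  rcases hq : q b with _ | ⟨i, _ | _⟩
  · have hn : (restrictM (planM p q) 1).mB 0 b = none :=
      Option.eq_none_iff_forall_ne_some.2 fun i hi => by simpa [hq] using (h i).1 hi
    rw [hn]
    rfl
  · simp [hq, Slot.at] at hb
  · have hi := (h i).2 hq
    have h0 : sInf {s | 0 ≤ s ∧ (restrictM (planM p q) 1).mB s b ≠ none} = 0 :=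
      Nat.sInf_eq_zero.2 (Or.inl ⟨le_rfl, by simp [hi]⟩)
    rw [hi, h0]
    simp [Slot.now, Slot.val]

theorem stable1_restrictM {P : Pref (Fin 4) (Fin 4)} (hP : Ex1Pref P)
    {F : Economy (Fin 4) (Fin 4)} (hT : F.T = 1) {p q p' q' : Fin 4 → Slot}
    (hX : F.arrA 0 ⊆ lateSet p) (hY : F.arrB 0 ⊆ lateSet q)
    (h : StableCompletion (F.arrA 0) (F.arrB 0) p q p' q') :
    Stable1 P F (restrictM (planM p' q') 1) := by
  obtain ⟨hp, hq, hpq, hlate, hA, hB, hblock⟩ := h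
  have hp0 : ∀ a ∈ F.arrA 0, (p' a).at 0 = none :=
    fun a ha => (hp a).trans (Finset.mem_filter.1 (hX ha)).2
  have hq0 : ∀ b ∈ F.arrB 0, (q' b).at 0 = none :=
    fun b hb => (hq b).trans (Finset.mem_filter.1 (hY hb)).2
  refine ⟨⟨fun t a b ht => ?_, fun t a ht hne => ?_, fun t a b ht hab => ?_,
    fun t s a hts hs _ => ?_, fun t s b hts hs _ => ?_⟩, fun a b hab => ?_, fun b a hab => ?_,
    fun a ha b hb hbl => ?_⟩
  · obtain rfl : t = 0 := by omega
    rw [restrictM_planM_mA, restrictM_planM_mB, hpq]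
  · obtain rfl : t = 0 := by omega
    obtain ⟨b, hb⟩ := Option.ne_none_iff_exists'.1 hne
    rw [arrAUpTo_zero]
    exact (hlate a b (restrictM_planM_mA.1 hb)).1
  · obtain rfl : t = 0 := by omega
    rw [arrBUpTo_zero]
    exact (hlate a b (restrictM_planM_mA.1 hab)).2
  · obtain rfl : s = t := by omega
    rfl
  · obtain rfl : s = t := by omega
    rfl
  · rw [hT] at hab
    have hab := restrictM_planM_mA.1 hab
    simpa [hab, Slot.now, Slot.val] using
      rankA_sound hP a (Or.inr rfl) (hA a (hlate a b hab).1)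
  · rw [hT] at hab
    have hab := restrictM_planM_mB.1 hab
    simpa [hab, Slot.now, Slot.val] using
      rankB_sound hP b (Or.inr rfl) (hB b (hlate a b ((hpq a b true).2 hab)).2)
  · rw [Upay_restrictM P hT (hp0 a ha), Vpay_restrictM P hT (hq0 b hb)] at hbl
    rcases hblock a ha b hb with h | h
    · exact hbl.1.not_ge (rankA_sound hP a (Or.inr rfl) h)
    · exact hbl.2.not_ge (rankB_sound hP b (Or.inr rfl) h)

theorem StableCompletion.consistent {S R X Y : Finset (Fin 4)} {p q p' q' : Fin 4 → Slot}
    (hc : Consistent S R p q) (h : StableCompletion X Y p q p' q') : Consistent S R p' q' :=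
  ⟨h.2.2.1, fun a b hab => hc.2 a b <| Slot.at_zero_eq_some.1 <|
    (h.1 a).symm.trans (Slot.at_zero_eq_some.2 hab)⟩

theorem StableCompletion.mem_MSetH {S R X Y : Finset (Fin 4)} {p q p' q' : Fin 4 → Slot}
    (hc : Consistent S R p q) (h : StableCompletion X Y p q p' q') :
    planM p' q' ∈ MSetH (econ S R) (planM p q) 1 := by
  refine ⟨isMatching_planM (h.consistent hc), fun s hs => ?_⟩
  obtain rfl : s = 0 := by omega
  exact ⟨fun a => (h.1 a).symm, fun b => (h.2.1 b).symm⟩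

theorem Slot.at_eq_none_of_late {x : Slot} (h : x.at 0 = none) (h' : ∀ j, x ≠ some (j, true))
    (t : ℕ) : x.at t = none := by
  rcases x with _ | ⟨j, _ | _⟩
  · rfl
  · simp [Slot.at] at h
  · exact absurd rfl (h' j)

theorem availA_one (S R : Finset (Fin 4)) (p q : Fin 4 → Slot) :
    availA (econ S R) (planM p q) 1 = lateSet p := by
  ext a
  simp [availA, arrAUpTo_econ_one, planM]

theorem availB_one (S R : Finset (Fin 4)) (p q : Fin 4 → Slot) :
    availB (econ S R) (planM p q) 1 = lateSet q := by
  ext b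
  simp [availB, arrBUpTo_econ_one, planM]

theorem exists_conjecture_one_A {P : Pref (Fin 4) (Fin 4)} (hP : Ex1Pref P)
    {RE : Economy (Fin 4) (Fin 4) → Set (PreMatching (Fin 4) (Fin 4))} (hRE : IsREFamily P RE)
    {S R : Finset (Fin 4)} {p q : Fin 4 → Slot} (hc : Consistent S R p q)
    (h2 : SecondPeriodOK p q) {a : Fin 4} (ha : a ∈ lateSet p) :
    ∃ m' ∈ reConj RE (econ S R) 1 (planM p q) (Sum.inl a),
      Upay P (econ S R) m' 1 a ≤ Upay P (econ S R) (planM p q) 1 a := by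
  have h := h2.2.1 a ha
  unfold HasCompletion at h
  generalize partners _ = p' at h
  generalize completion _ _ _ = q' at h
  have hM := h.mem_MSetH hc
  have hnone : ∀ t, (p' a).at t = none :=
    Slot.at_eq_none_of_late ((h.1 a).trans (Finset.mem_filter.1 ha).2)
      fun j hj => by simpa using (h.2.2.2.1 a j hj).1
  refine ⟨planM p' q', ⟨⟨hM.1, hM.2, fun s _ => hnone s⟩, ?_⟩, ?_⟩
  · set F := delayEconomy (contEconomy (econ S R) (planM p q) 1) (Sum.inl a)
    have hA : F.arrA 0 = lateSet p \ {a} := by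
      rw [← availA_one S R p q]
      rfl
    have hB : F.arrB 0 = lateSet q \ ∅ := by
      rw [← availB_one S R p q, Finset.sdiff_empty]
      rfl
    rw [hRE.1 F rfl]
    rw [← hA, ← hB] at h
    exact stable1_restrictM hP rfl (hA ▸ Finset.sdiff_subset) (hB ▸ Finset.sdiff_subset) h
  · have h0 : p' a = none := by
      rcases hx : p' a with _ | ⟨j, l⟩
      · rfl
      · simpa [hx, Slot.at] using hnone 1
    rw [Upay_one, Upay_one, h0]
    exact rankA_sound hP a (Or.inr rfl) (h2.1.1 a ha)

theorem exists_conjecture_one_B {P : Pref (Fin 4) (Fin 4)} (hP : Ex1Pref P)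
    {RE : Economy (Fin 4) (Fin 4) → Set (PreMatching (Fin 4) (Fin 4))} (hRE : IsREFamily P RE)
    {S R : Finset (Fin 4)} {p q : Fin 4 → Slot} (hc : Consistent S R p q)
    (h2 : SecondPeriodOK p q) {b : Fin 4} (hb : b ∈ lateSet q) :
    ∃ m' ∈ reConj RE (econ S R) 1 (planM p q) (Sum.inr b),
      Vpay P (econ S R) m' 1 b ≤ Vpay P (econ S R) (planM p q) 1 b := by
  have h := h2.2.2 b hb
  unfold HasCompletion at h
  generalize partners _ = p' at h
  generalize completion _ _ _ = q' at h
  have hM := h.mem_MSetH hc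
  have hnone : ∀ t, (q' b).at t = none :=
    Slot.at_eq_none_of_late ((h.2.1 b).trans (Finset.mem_filter.1 hb).2)
      fun j hj => by simpa using (h.2.2.2.1 j b ((h.2.2.1 j b true).2 hj)).2
  refine ⟨planM p' q', ⟨⟨hM.1, hM.2, fun s _ => hnone s⟩, ?_⟩, ?_⟩
  · set F := delayEconomy (contEconomy (econ S R) (planM p q) 1) (Sum.inr b)
    have hA : F.arrA 0 = lateSet p \ ∅ := by
      rw [← availA_one S R p q, Finset.sdiff_empty]
      rfl
    have hB : F.arrB 0 = lateSet q \ {b} := by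
      rw [← availB_one S R p q]
      rfl
    rw [hRE.1 F rfl]
    rw [← hA, ← hB] at h
    exact stable1_restrictM hP rfl (hA ▸ Finset.sdiff_subset) (hB ▸ Finset.sdiff_subset) h
  · have h0 : q' b = none := by
      rcases hx : q' b with _ | ⟨j, l⟩
      · rfl
      · simpa [hx, Slot.at] using hnone 1
    rw [Vpay_one, Vpay_one, h0]
    exact rankB_sound hP b (Or.inr rfl) (h2.1.2.1 b hb)

theorem contEconomy_zero (S R : Finset (Fin 4)) (m : PreMatching (Fin 4) (Fin 4)) :
    contEconomy (econ S R) m 0 = econ S R := by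
  simp only [contEconomy, availA_zero, availB_zero, econ, Nat.sub_zero, Nat.zero_add]
  congr 1 <;> funext s <;> split_ifs <;> rfl

theorem delayEconomy_inl (S R : Finset (Fin 4)) (a : Fin 4) :
    delayEconomy (econ S R) (Sum.inl a) = econ (S \ {a}) R := by
  simp only [delayEconomy, econ]
  congr 1
  funext s
  split_ifs <;> simp_all
  ext x
  by_cases hx : x = a <;> simp [hx]

theorem delayEconomy_inr (S R : Finset (Fin 4)) (b : Fin 4) :
    delayEconomy (econ S R) (Sum.inr b) = econ S (R \ {b}) := by
  simp only [delayEconomy, econ]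
  congr 1
  funext s
  split_ifs <;> simp_all
  ext x
  by_cases hx : x = b <;> simp [hx]

theorem restrictM_zero (m : PreMatching (Fin 4) (Fin 4)) : restrictM m 0 = m := by
  simp [restrictM]

theorem Consistent.mono {S S' R R' : Finset (Fin 4)} {p q : Fin 4 → Slot}
    (h : Consistent S R p q) (hS : S ⊆ S') (hR : R ⊆ R') : Consistent S' R' p q :=
  ⟨h.1, fun a b hab => ⟨hS (h.2 a b hab).1, hR (h.2 a b hab).2⟩⟩

theorem Consistent.at_zero_left {S R : Finset (Fin 4)} {p q : Fin 4 → Slot}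
    (h : Consistent S R p q) {a : Fin 4} (ha : a ∉ S) : (p a).at 0 = none :=
  Slot.at_zero_eq_none.2 fun _ hj => ha (h.2 _ _ hj).1

theorem Consistent.at_zero_right {S R : Finset (Fin 4)} {p q : Fin 4 → Slot}
    (h : Consistent S R p q) {b : Fin 4} (hb : b ∉ R) : (q b).at 0 = none :=
  Slot.at_zero_eq_none.2 fun _ hj => hb (h.2 _ _ ((h.1 _ _ _).2 hj)).2

/-- The requirements on the first period of a solution, except for those involving
conjectures. -/
def FirstPeriodOK (S R : Finset (Fin 4)) (p q : Fin 4 → Slot) : Prop :=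
  Consistent S R p q ∧ 3 ∉ S ∧ 2 ∉ R ∧ 3 ∉ R ∧
  ∀ a ∈ S, ∀ b ∈ R, RankLe (rankA a) (some (b, false)) (p a) ∨
    RankLe (rankB b) (some (a, false)) (q b)

instance (S R : Finset (Fin 4)) (p q : Fin 4 → Slot) : Decidable (FirstPeriodOK S R p q) :=
  inferInstanceAs (Decidable (_ ∧ _ ∧ _ ∧ _ ∧ _))

theorem planM_mem_RE {P : Pref (Fin 4) (Fin 4)} (hP : Ex1Pref P)
    {RE : Economy (Fin 4) (Fin 4) → Set (PreMatching (Fin 4) (Fin 4))} (hRE : IsREFamily P RE)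
    {S R : Finset (Fin 4)} {p q : Fin 4 → Slot} (h1 : FirstPeriodOK S R p q)
    (h2 : SecondPeriodOK p q)
    (hA : ∀ a ∈ S, ∃ p' q', Consistent (S \ {a}) R p' q' ∧
      planM p' q' ∈ RE (econ (S \ {a}) R) ∧ RankLe (rankA a) (p' a) (p a))
    (hB : ∀ b ∈ R, ∃ p' q', Consistent S (R \ {b}) p' q' ∧
      planM p' q' ∈ RE (econ S (R \ {b})) ∧ RankLe (rankB b) (q' b) (q b)) :
    planM p q ∈ RE (econ S R) := by
  obtain ⟨hc, h3, h2', h3', hblock⟩ := h1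
  rw [hRE.2 _ le_rfl]
  refine ⟨isMatching_planM hc, fun t ht => ?_⟩
  obtain rfl | rfl : t = 0 ∨ t = 1 := by simp only [econ] at ht; omega
  · rw [availA_zero, availB_zero]
    refine ⟨fun a ha => ?_, fun b hb => ?_, fun a ha b hb hbl => ?_⟩
    · replace ha : a ∈ S := ha
      obtain ⟨p', q', hc', hm, hr⟩ := hA a ha
      refine ⟨planM p' q', ⟨⟨isMatching_planM (hc'.mono Finset.sdiff_subset subset_rfl),
        fun s hs => absurd hs (Nat.not_lt_zero s), fun s hs => ?_⟩, ?_⟩, ?_⟩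
      · obtain rfl : s = 0 := by omega
        exact hc'.at_zero_left (by simp)
      · rwa [contEconomy_zero, delayEconomy_inl, restrictM_zero]
      · rw [Upay_zero, Upay_zero]
        exact rankA_sound hP a (Or.inl fun h => h3 (h ▸ ha)) hr
    · replace hb : b ∈ R := hb
      obtain ⟨p', q', hc', hm, hr⟩ := hB b hb
      refine ⟨planM p' q', ⟨⟨isMatching_planM (hc'.mono subset_rfl Finset.sdiff_subset),
        fun s hs => absurd hs (Nat.not_lt_zero s), fun s hs => ?_⟩, ?_⟩, ?_⟩
      · obtain rfl : s = 0 := by omega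
        exact hc'.at_zero_right (by simp)
      · rwa [contEconomy_zero, delayEconomy_inr, restrictM_zero]
      · rw [Vpay_zero, Vpay_zero]
        refine rankB_sound hP b (Or.inl ?_) hr
        have hb2 : b ≠ 2 := fun h => h2' (h ▸ hb)
        have hb3 : b ≠ 3 := fun h => h3' (h ▸ hb)
        omega
    · rw [Upay_zero, Vpay_zero] at hbl
      rcases hblock a ha b hb with h | h
      · exact hbl.1.not_ge (rankA_sound hP a (Or.inr rfl) h)
      · exact hbl.2.not_ge (rankB_sound hP b (Or.inr rfl) h)
  · rw [availA_one, availB_one]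
    refine ⟨fun a ha => exists_conjecture_one_A hP hRE hc h2 ha,
      fun b hb => exists_conjecture_one_B hP hRE hc h2 hb, fun a ha b hb hbl => ?_⟩
    rw [Upay_one, Vpay_one] at hbl
    rcases h2.1.2.2 a ha b hb with h | h
    · exact hbl.1.not_ge (rankA_sound hP a (Or.inr rfl) h)
    · exact hbl.2.not_ge (rankB_sound hP b (Or.inr rfl) h)

/-- A rational expectations solution of `econ S R`. -/
def sol (S R : Finset (Fin 4)) : Fin 4 → Slot :=
  if 2 ∈ S ∧ 1 ∈ R then if 0 ∈ S ∧ 0 ∈ R then planA1A3 else planA3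
  else if 0 ∈ S ∧ 1 ∈ R then planA1 else planLate

/-- The comparisons of `sol S R` with the solutions when one more arrival is delayed. -/
def SolStep (S R : Finset (Fin 4)) : Prop :=
  FirstPeriodOK S R (sol S R) (partners (sol S R)) ∧
  (∀ a ∈ S, RankLe (rankA a) (sol (S \ {a}) R a) (sol S R a)) ∧
  ∀ b ∈ R, RankLe (rankB b) (partners (sol S (R \ {b})) b) (partners (sol S R) b)

instance (S R : Finset (Fin 4)) : Decidable (SolStep S R) :=
  inferInstanceAs (Decidable (_ ∧ _ ∧ _))

set_option maxRecDepth 10000 in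
theorem solStep : ∀ S ∈ ({0, 1, 2} : Finset (Fin 4)).powerset,
    ∀ R ∈ ({0, 1} : Finset (Fin 4)).powerset, SolStep S R := by decide

theorem secondPeriodOK_sol (S R : Finset (Fin 4)) :
    SecondPeriodOK (sol S R) (partners (sol S R)) := by
  unfold sol
  split_ifs
  exacts [secondPeriodOK_planA1A3, secondPeriodOK_planA3, secondPeriodOK_planA1,
    secondPeriodOK_planLate]

theorem sol_mem_RE {P : Pref (Fin 4) (Fin 4)} (hP : Ex1Pref P)
    {RE : Economy (Fin 4) (Fin 4) → Set (PreMatching (Fin 4) (Fin 4))} (hRE : IsREFamily P RE)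
    (S R : Finset (Fin 4)) (hS : S ⊆ {0, 1, 2}) (hR : R ⊆ {0, 1}) :
    planM (sol S R) (partners (sol S R)) ∈ RE (econ S R) := by
  have step : ∀ {S R : Finset (Fin 4)}, S ⊆ {0, 1, 2} → R ⊆ {0, 1} → SolStep S R :=
    fun hS hR => solStep _ (Finset.mem_powerset.2 hS) _ (Finset.mem_powerset.2 hR)
  obtain ⟨h1, hA, hB⟩ := step hS hR
  refine planM_mem_RE hP hRE h1 (secondPeriodOK_sol S R) (fun a ha => ?_) (fun b hb => ?_)
  · have hS' : S \ {a} ⊆ {0, 1, 2} := Finset.sdiff_subset.trans hS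
    exact ⟨_, _, (step hS' hR).1.1, sol_mem_RE hP hRE _ R hS' hR, hA a ha⟩
  · have hR' : R \ {b} ⊆ {0, 1} := Finset.sdiff_subset.trans hR
    exact ⟨_, _, (step hS hR').1.1, sol_mem_RE hP hRE S _ hS hR', hB b hb⟩
termination_by S.card + R.card
decreasing_by
  · have := Finset.card_lt_card (Finset.sdiff_ssubset (Finset.singleton_subset_iff.2 ha)
      (Finset.singleton_nonempty a))
    omega
  · have := Finset.card_lt_card (Finset.sdiff_ssubset (Finset.singleton_subset_iff.2 hb)
      (Finset.singleton_nonempty b))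
    omega

theorem E1_eq : E1 = econ {0, 1, 2} {0, 1} := by
  simp only [E1, econ]
  congr 1

theorem ma2_eq : ma2 = planM planMa2 (partners planMa2) := by
  simp only [ma2, planM, PreMatching.mk.injEq]
  constructor <;> funext t x <;> rcases t with _ | t <;> fin_cases x <;> rfl

theorem mb1_eq : mb1 = planM planA3 (partners planA3) := by
  simp only [mb1, planM, PreMatching.mk.injEq]
  constructor <;> funext t x <;> rcases t with _ | t <;> fin_cases x <;> rfl

theorem ma2_step : FirstPeriodOK {0, 2} {0, 1} planMa2 (partners planMa2) ∧
    (∀ a ∈ ({0, 2} : Finset (Fin 4)),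
      RankLe (rankA a) (sol ({0, 2} \ {a}) {0, 1} a) (planMa2 a)) ∧
    ∀ b ∈ ({0, 1} : Finset (Fin 4)),
      RankLe (rankB b) (partners (sol {0, 2} ({0, 1} \ {b})) b) (partners planMa2 b) :=
  ⟨by decide, by decide, by decide⟩

/-- `m_{a2}` is a rational expectations solution of `E²_{\a2}` and
`m_{b1}` is a rational expectations solution of `E²_{\b1}`. -/
theorem statement15 (P : Pref (Fin 4) (Fin 4)) (hP : Ex1Pref P)
    (RE : Economy (Fin 4) (Fin 4) → Set (PreMatching (Fin 4) (Fin 4)))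
    (hRE : IsREFamily P RE) :
    ma2 ∈ RE (delayEconomy E1 (Sum.inl 1)) ∧
    mb1 ∈ RE (delayEconomy E1 (Sum.inr 0)) := by
  rw [E1_eq, delayEconomy_inl, delayEconomy_inr, ma2_eq, mb1_eq]
  have e1 : ({0, 1, 2} : Finset (Fin 4)) \ {1} = {0, 2} := by decide
  have e2 : sol {0, 1, 2} ({0, 1} \ {0}) = planA3 := by decide
  have hmb1 := sol_mem_RE hP hRE {0, 1, 2} ({0, 1} \ {0}) subset_rfl Finset.sdiff_subset
  rw [e2] at hmb1
  refine ⟨?_, hmb1⟩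
  rw [e1]
  obtain ⟨h1, hA, hB⟩ := ma2_step
  have hS : ({0, 2} : Finset (Fin 4)) ⊆ {0, 1, 2} := by decide
  refine planM_mem_RE hP hRE h1 secondPeriodOK_planMa2 (fun a ha => ?_) (fun b hb => ?_)
  · have hS' := (Finset.sdiff_subset (t := {a})).trans hS
    exact ⟨_, _, (solStep _ (Finset.mem_powerset.2 hS') _ (Finset.mem_powerset_self _)).1.1,
      sol_mem_RE hP hRE _ _ hS' subset_rfl, hA a ha⟩
  · have hR' : ({0, 1} : Finset (Fin 4)) \ {b} ⊆ {0, 1} := Finset.sdiff_subset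
    exact ⟨_, _, (solStep _ (Finset.mem_powerset.2 hS) _ (Finset.mem_powerset.2 hR')).1.1,
      sol_mem_RE hP hRE _ _ hS hR', hB b hb⟩

end

end DynMatch
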